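/- arXiv:2510.08658 — 12 statements merged into one kernel-verified Lean document; each statement's English description precedes it below -/
import Mathlib

section
/- If the three sets 𝔸(0; b, λ), 𝔸(1/2; b, λ), 𝔸(1; b, λ) are all nonempty, then their endpoints are ordered as follows: sInf 𝔸(0; b, λ) ≤ sInf 𝔸(1/2; b, λ) ≤ sSup 𝔸(0; b, λ) ≤ sInf 𝔸(1; b, λ) ≤ sSup 𝔸(1/2; b, λ) ≤ sSup 𝔸(1; b, λ). -/
/-- The cost of choosing action `a` when the agent's own credence is `θ`,
the perceived peer average is `b`, and sensitivity is `lam`. -/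
noncomputable def cost (b lam a θ : ℝ) : ℝ := |a - θ| + lam * |a - b|

/-- The best-response belief set `𝔸(a; b, λ)`. -/
noncomputable def BRset (b lam a : ℝ) : Set ℝ :=
  {θ | θ ∈ Set.Icc (0 : ℝ) 1 ∧
    ∀ a' ∈ ({0, 1/2, 1} : Set ℝ), cost b lam a θ ≤ cost b lam a' θ}

theorem mem_BR_iff (b lam a θ : ℝ) : θ ∈ BRset b lam a ↔ (0 ≤ θ ∧ θ ≤ 1) ∧
    |a - θ| + lam * |a - b| ≤ |0 - θ| + lam * |0 - b| ∧
    |a - θ| + lam * |a - b| ≤ |1/2 - θ| + lam * |1/2 - b| ∧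
    |a - θ| + lam * |a - b| ≤ |1 - θ| + lam * |1 - b| := by
  simp [BRset, cost]

theorem key (c0 ch c1 b lam : ℝ) (hlam : 0 ≤ lam) (e0 : lam * |0 - b| = c0)
    (eh : lam * |1/2 - b| = ch) (e1 : lam * |1 - b| = c1)
    (hc : (ch - c1 = -lam/2 ∧ ch - c0 ≤ lam/2) ∨ (ch - c0 = -lam/2 ∧ ch - c1 ≤ lam/2))
    (h0 : (BRset b lam 0).Nonempty) (h1 : (BRset b lam 1).Nonempty) :
    (0:ℝ) ∈ BRset b lam 0 ∧ (1:ℝ) ∈ BRset b lam 1 ∧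
    (∃ t, t ∈ BRset b lam 0 ∧ t ∈ BRset b lam (1/2)) ∧
    (∃ t, t ∈ BRset b lam 1 ∧ t ∈ BRset b lam (1/2)) ∧
    ∀ x ∈ BRset b lam 0, ∀ y ∈ BRset b lam 1, x ≤ y := by
  obtain ⟨u, hu⟩ := h0
  obtain ⟨v, hv⟩ := h1
  simp only [mem_BR_iff, e0, eh, e1] at *
  have k0 : -1/2 ≤ ch - c0 := by grind
  have k1 : -1/2 ≤ ch - c1 := by grind
  have hl : lam ≤ 1 := by grind
  clear hu hv e0 eh e1
  refine ⟨by grind, by grind, ⟨1/4+(ch-c0)/2, ?_, ?_⟩, ⟨3/4-(ch-c1)/2, ?_, ?_⟩, ?_⟩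
  · grind
  · grind
  · grind
  · grind
  · intro x hx y hy
    grind

theorem brset_endpoints_ordered
    (b lam : ℝ) (hb : b ∈ Set.Icc (0 : ℝ) 1) (hlam : 0 ≤ lam)
    (h0 : (BRset b lam 0).Nonempty) (hhalf : (BRset b lam (1/2)).Nonempty)
    (h1 : (BRset b lam 1).Nonempty) :
    sInf (BRset b lam 0) ≤ sInf (BRset b lam (1/2)) ∧
    sInf (BRset b lam (1/2)) ≤ sSup (BRset b lam 0) ∧
    sSup (BRset b lam 0) ≤ sInf (BRset b lam 1) ∧
    sInf (BRset b lam 1) ≤ sSup (BRset b lam (1/2)) ∧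
    sSup (BRset b lam (1/2)) ≤ sSup (BRset b lam 1) := by
  obtain ⟨hb0, hb1⟩ := hb
  have m0 := mul_nonneg hlam hb0
  have m1 := mul_nonneg hlam (sub_nonneg.2 hb1)
  obtain ⟨k0, k1, ⟨t, t0, th⟩, ⟨s, s1, sh⟩, hxy⟩ := key _ _ _ b lam hlam rfl rfl rfl (by
    rw [abs_of_nonpos (by linarith : 0 - b ≤ 0), abs_of_nonneg (by linarith : 0 ≤ 1 - b)]
    rcases le_total b (1/2) with h | h
    · rw [abs_of_nonneg (by linarith : 0 ≤ 1/2 - b)]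
      left; constructor <;> nlinarith
    · rw [abs_of_nonpos (by linarith : 1/2 - b ≤ 0)]
      right; constructor <;> nlinarith) h0 h1
  have bb : ∀ a, BddBelow (BRset b lam a) := fun a => ⟨0, fun x hx => hx.1.1⟩
  have ba : ∀ a, BddAbove (BRset b lam a) := fun a => ⟨1, fun x hx => hx.1.2⟩
  refine ⟨?_, (csInf_le (bb _) th).trans (le_csSup (ba _) t0), ?_,
    (csInf_le (bb _) s1).trans (le_csSup (ba _) sh), ?_⟩
  · exact (csInf_le (bb _) k0).trans (le_csInf hhalf fun x hx => hx.1.1)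
  · exact csSup_le h0 fun x hx => le_csInf h1 fun y hy => hxy x hx y hy
  · exact (csSup_le hhalf fun x hx => hx.1.2).trans (le_csSup (ba _) k1)
end

section
/- If the interiors (in ℝ) of 𝔸(0; b, λ) and 𝔸(1/2; b, λ) have a common point, then the degeneracy condition λ·(|1/2 − b| − b) = 1/2 holds. In particular, for all parameters (b, λ) not satisfying this equation, the interiors of 𝔸(0; b, λ) and 𝔸(1/2; b, λ) are disjoint. -/
theorem interior_br0_brhalf_overlap_degenerate
    (b lam : ℝ) (hb : b ∈ Set.Icc (0 : ℝ) 1) (hlam : 0 ≤ lam) :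
    ((interior (BRset b lam 0) ∩ interior (BRset b lam (1/2))).Nonempty →
      lam * (|1/2 - b| - b) = 1/2) ∧
    (lam * (|1/2 - b| - b) ≠ 1/2 →
      interior (BRset b lam 0) ∩ interior (BRset b lam (1/2)) = ∅) := by
  have key : (interior (BRset b lam 0) ∩ interior (BRset b lam (1/2))).Nonempty →
      lam * (|1/2 - b| - b) = 1/2 := by
    rintro ⟨x, hx⟩
    have hind : ∀ y ∈ interior (BRset b lam 0) ∩ interior (BRset b lam (1/2)),
        y + lam * b = |1/2 - y| + lam * |1/2 - b| := by
      intro y hy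
      have h0 := interior_subset hy.1
      have h1 := interior_subset hy.2
      have e0 := h0.2 (1/2) (by simp)
      have e1 := h1.2 0 (by simp)
      have e := le_antisymm e0 e1
      simp only [cost, zero_sub, abs_neg, abs_of_nonneg h0.1.1, abs_of_nonneg hb.1] at e
      exact e
    have hopen : IsOpen (interior (BRset b lam 0) ∩ interior (BRset b lam (1/2))) :=
      isOpen_interior.inter isOpen_interior
    obtain ⟨ε, hε, hball⟩ := Metric.isOpen_iff.1 hopen x hx
    have hz := hball (show x + ε / 2 ∈ Metric.ball x ε by
      rw [Metric.mem_ball, Real.dist_eq, add_sub_cancel_left, abs_of_pos (by linarith)]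
      linarith)
    have h1 := hind x hx
    have h2 := hind _ hz
    rw [mul_sub]
    rcases le_or_gt (1/2) x with h | h
    · rw [abs_of_nonpos (by linarith : 1/2 - x ≤ 0)] at h1
      linarith
    · exfalso
      rw [abs_of_pos (by linarith : 0 < 1/2 - x)] at h1
      have h3 : |1/2 - (x + ε/2)| < 1/2 - x + ε / 2 := by
        rw [abs_lt]; constructor <;> linarith
      linarith
  exact ⟨key, fun h => Set.not_nonempty_iff_eq_empty.1 fun hn => h (key hn)⟩
end

section
/- If the interiors (in ℝ) of 𝔸(1/2; b, λ) and 𝔸(1; b, λ) have a common point, then the degeneracy condition λ·(|1/2 − b| − (1 − b)) = 1/2 holds. In particular, for all parameters (b, λ) not satisfying this equation, the interiors of 𝔸(1/2; b, λ) and 𝔸(1; b, λ) are disjoint. -/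
theorem interior_brhalf_br1_overlap_degenerate
    (b lam : ℝ) (hb : b ∈ Set.Icc (0 : ℝ) 1) (hlam : 0 ≤ lam) :
    ((interior (BRset b lam (1/2)) ∩ interior (BRset b lam 1)).Nonempty →
      lam * (|1/2 - b| - (1 - b)) = 1/2) ∧
    (lam * (|1/2 - b| - (1 - b)) ≠ 1/2 →
      interior (BRset b lam (1/2)) ∩ interior (BRset b lam 1) = ∅) := by
  have key : (interior (BRset b lam (1/2)) ∩ interior (BRset b lam 1)).Nonempty →
      lam * (|1/2 - b| - (1 - b)) = 1/2 := by
    rintro ⟨x, hx⟩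
    have heq : ∀ y, y ∈ interior (BRset b lam (1/2)) ∩ interior (BRset b lam 1) →
        |1/2 - y| + lam * |1/2 - b| = (1 - y) + lam * (1 - b) := by
      rintro y ⟨h1, h2⟩
      have h1 := interior_subset h1
      have h2 := interior_subset h2
      have e1 := h1.2 1 (by simp)
      have e2 := h2.2 (1/2) (by simp)
      have hy := h1.1.2
      have hb1 := hb.2
      unfold cost at e1 e2
      rw [abs_of_nonneg (by linarith : (0:ℝ) ≤ 1 - y),
        abs_of_nonneg (by linarith : (0:ℝ) ≤ 1 - b)] at e1 e2
      exact le_antisymm e1 e2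
    have hopen : IsOpen (interior (BRset b lam (1/2)) ∩ interior (BRset b lam 1)) :=
      isOpen_interior.inter isOpen_interior
    obtain ⟨ε, hε, hball⟩ := Metric.isOpen_iff.1 hopen x hx
    have ex := heq x hx
    have ey := heq (x + ε / 2) (hball (by
      rw [Metric.mem_ball, Real.dist_eq, add_sub_cancel_left, abs_of_pos (by linarith)]
      linarith))
    rcases le_total x (1/2) with h | h
    · rw [abs_of_nonneg (by linarith : (0:ℝ) ≤ 1/2 - x)] at ex
      linarith
    · rw [abs_of_nonpos (by linarith : 1/2 - x ≤ (0:ℝ))] at ex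
      rw [abs_of_nonpos (by linarith : 1/2 - (x + ε / 2) ≤ (0:ℝ))] at ey
      linarith
  refine ⟨key, fun hne => ?_⟩
  by_contra hcon
  exact hne (key (Set.nonempty_iff_ne_empty.2 hcon))
end

section
/- If both 𝔸(0; b, λ) and 𝔸(1; b, λ) are nonempty, then 𝔸(1/2; b, λ) is nonempty. (Equivalently: if 𝔸(1/2; b, λ) = ∅, then 𝔸(0; b, λ) = ∅ or 𝔸(1; b, λ) = ∅.) -/
theorem brhalf_nonempty_of_br0_br1_nonempty
    (b lam : ℝ) (hb : b ∈ Set.Icc (0 : ℝ) 1) (hlam : 0 ≤ lam)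
    (h0 : (BRset b lam 0).Nonempty) (h1 : (BRset b lam 1).Nonempty) :
    (BRset b lam (1/2)).Nonempty := by
  obtain ⟨hb0, hb1⟩ := hb
  obtain ⟨t, ⟨ht0, ht1⟩, ht⟩ := h0
  obtain ⟨s, ⟨hs0, hs1⟩, hs⟩ := h1
  have t1 := ht (1/2) (by simp)
  have s1 := hs (1/2) (by simp)
  simp only [cost] at t1 s1
  have e0 : |(0:ℝ) - b| = b := by rw [zero_sub, abs_neg, abs_of_nonneg hb0]
  have e1 : |(1:ℝ) - b| = 1 - b := abs_of_nonneg (by linarith)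
  have e2 : |(0:ℝ) - t| = t := by rw [zero_sub, abs_neg, abs_of_nonneg ht0]
  have e3 : |(1:ℝ) - s| = 1 - s := abs_of_nonneg (by linarith)
  have k1 : |(1/2:ℝ) - t| ≤ 1/2 + t := abs_le.2 ⟨by linarith, by linarith⟩
  have k2 : |(1/2:ℝ) - s| ≤ 1/2 + (1 - s) := abs_le.2 ⟨by linarith, by linarith⟩
  rw [e0, e2] at t1
  rw [e1, e3] at s1
  have e4 : |(1/2:ℝ) - 1/2| = 0 := by norm_num
  have e5 : |(0:ℝ) - 1/2| = 1/2 := by norm_num [abs_of_pos]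
  have e6 : |(1:ℝ) - 1/2| = 1/2 := by norm_num [abs_of_pos]
  refine ⟨1/2, ⟨by norm_num, by norm_num⟩, ?_⟩
  rintro a (rfl | rfl | rfl)
  · simp only [cost, e0, e4, e5]
    rcases le_total b (1/2) with h | h
    · rw [abs_of_nonneg (by linarith : (0:ℝ) ≤ 1/2 - b)] at *
      nlinarith [mul_nonneg hlam hb0]
    · rw [abs_of_nonpos (by linarith : (1/2:ℝ) - b ≤ 0)] at *
      nlinarith
  · exact le_rfl
  · simp only [cost, e1, e4, e6]
    rcases le_total b (1/2) with h | h
    · rw [abs_of_nonneg (by linarith : (0:ℝ) ≤ 1/2 - b)] at *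
      nlinarith
    · rw [abs_of_nonpos (by linarith : (1/2:ℝ) - b ≤ 0)] at *
      nlinarith [mul_nonneg hlam (sub_nonneg.2 hb1)]
end

section
/- Suppose a* ∈ {0, 1/2, 1} is a closest action to b, i.e. |a* − b| ≤ |a − b| for all a ∈ {0, 1/2, 1}. Then for all 0 ≤ λ ≤ λ', 𝔸(a*; b, λ) ⊆ 𝔸(a*; b, λ'). -/
theorem brset_closest_action_monotone_in_lambda
    (b : ℝ) (hb : b ∈ Set.Icc (0 : ℝ) 1)
    (astar : ℝ) (hastar : astar ∈ ({0, 1/2, 1} : Set ℝ))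
    (hclosest : ∀ a ∈ ({0, 1/2, 1} : Set ℝ), |astar - b| ≤ |a - b|)
    (lam lam' : ℝ) (hlam : 0 ≤ lam) (hle : lam ≤ lam') :
    BRset b lam astar ⊆ BRset b lam' astar := by
  rintro θ ⟨hθ, h⟩
  refine ⟨hθ, fun a ha => ?_⟩
  have h1 := h a ha
  have h2 := mul_le_mul_of_nonneg_left (hclosest a ha) (sub_nonneg.2 hle)
  unfold cost at *
  linarith
end

section
/- Suppose a* ∈ {0, 1/2, 1} is the unique closest action to b, i.e. |a* − b| < |a − b| for all a ∈ {0, 1/2, 1} with a ≠ a*. Then for every θ ∈ [0,1] there exists λ ≥ 0 such that θ ∈ 𝔸(a*; b, λ). -/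
theorem exists_lambda_of_unique_closest
    (b : ℝ) (hb : b ∈ Set.Icc (0 : ℝ) 1)
    (astar : ℝ) (hastar : astar ∈ ({0, 1/2, 1} : Set ℝ))
    (hclosest : ∀ a ∈ ({0, 1/2, 1} : Set ℝ), a ≠ astar → |astar - b| < |a - b|)
    (θ : ℝ) (hθ : θ ∈ Set.Icc (0 : ℝ) 1) :
    ∃ lam : ℝ, 0 ≤ lam ∧ θ ∈ BRset b lam astar := by
  have key : ∀ a ∈ ({0, 1/2, 1} : Set ℝ), ∃ M : ℝ, 0 ≤ M ∧
      ∀ lam, M ≤ lam → cost b lam astar θ ≤ cost b lam a θ := by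
    intro a ha
    by_cases h : a = astar
    · exact ⟨0, le_refl _, fun lam _ => by rw [h]⟩
    · have hd : 0 < |a - b| - |astar - b| := sub_pos.mpr (hclosest a ha h)
      refine ⟨|astar - θ| / (|a - b| - |astar - b|), by positivity, fun lam hl => ?_⟩
      rw [div_le_iff₀ hd] at hl
      unfold cost
      have := abs_nonneg (a - θ)
      linarith
  obtain ⟨M0, h0, k0⟩ := key 0 (by simp)
  obtain ⟨M1, h1, k1⟩ := key (1/2) (by simp)
  obtain ⟨M2, h2, k2⟩ := key 1 (by simp)
  refine ⟨M0 + M1 + M2, by positivity, hθ, ?_⟩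
  rintro a (rfl | rfl | rfl)
  · exact k0 _ (by linarith)
  · exact k1 _ (by linarith)
  · exact k2 _ (by linarith)
end

section
/- Suppose 0 ≤ b < 1/4 and λ > 1/(1 − 4b). Then for every θ ∈ [0,1] and every a ∈ {1/2, 1}, one has θ + λ·b < |a − θ| + λ·|a − b|; that is, action 0 is the strictly optimal response regardless of the agent's own credence θ. Consequently 𝔸(0; b, λ) = [0,1] and 𝔸(1/2; b, λ) = 𝔸(1; b, λ) = ∅. -/
theorem high_sensitivity_forces_disapproval
    (b lam : ℝ) (hb0 : 0 ≤ b) (hb : b < 1/4) (hlam : 1 / (1 - 4 * b) < lam) :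
    (∀ θ ∈ Set.Icc (0 : ℝ) 1, ∀ a ∈ ({1/2, 1} : Set ℝ),
      θ + lam * b < |a - θ| + lam * |a - b|) ∧
    BRset b lam 0 = Set.Icc (0 : ℝ) 1 ∧
    BRset b lam (1/2) = ∅ ∧
    BRset b lam 1 = ∅ := by
  have h1 : 1 < lam * (1 - 4 * b) := by
    rwa [div_lt_iff₀ (by linarith)] at hlam
  have hl : 0 < lam := lt_trans (by apply one_div_pos.mpr; linarith) hlam
  have hlb : 0 ≤ lam * b := mul_nonneg hl.le hb0
  have key : ∀ θ ∈ Set.Icc (0 : ℝ) 1, ∀ a ∈ ({1/2, 1} : Set ℝ),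
      θ + lam * b < |a - θ| + lam * |a - b| := by
    rintro θ ⟨h0, h1'⟩ a ha
    simp only [Set.mem_insert_iff, Set.mem_singleton_iff] at ha
    rcases ha with rfl | rfl
    · rw [abs_of_nonneg (by linarith : (0:ℝ) ≤ 1/2 - b)]
      have := neg_abs_le (1/2 - θ)
      nlinarith
    · rw [abs_of_nonneg (by linarith : (0:ℝ) ≤ 1 - b)]
      have := le_abs_self (1 - θ)
      nlinarith
  have c0 : ∀ θ ∈ Set.Icc (0 : ℝ) 1, cost b lam 0 θ = θ + lam * b := by
    rintro θ ⟨h0, _⟩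
    simp [cost, abs_of_nonneg h0, abs_of_nonneg hb0]
  refine ⟨key, ?_, ?_, ?_⟩
  · ext θ
    refine ⟨fun h => h.1, fun h => ⟨h, ?_⟩⟩
    intro a ha
    rcases ha with rfl | ha
    · exact le_rfl
    · rw [c0 θ h]
      exact (key θ h a ha).le
  · refine Set.eq_empty_of_forall_notMem fun θ h => ?_
    have h2 := h.2 0 (by simp)
    rw [c0 θ h.1] at h2
    exact absurd (key θ h.1 (1/2) (by simp)) (not_lt.mpr h2)
  · refine Set.eq_empty_of_forall_notMem fun θ h => ?_
    have h2 := h.2 0 (by simp)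
    rw [c0 θ h.1] at h2
    exact absurd (key θ h.1 1 (by simp)) (not_lt.mpr h2)
end

section
/- Suppose b > 1/4 (so 0 is not the closest action to b among {0, 1/2, 1}). If θ ∈ 𝔸(0; b, λ) for some λ ≥ 0, then θ ∈ 𝔸(0; b, λ') for every λ' with 0 ≤ λ' ≤ λ. -/
theorem br0_persists_for_smaller_lambda
    (b : ℝ) (hb : b ∈ Set.Icc (0 : ℝ) 1) (hb4 : 1/4 < b)
    (θ lam : ℝ) (hlam : 0 ≤ lam) (hmem : θ ∈ BRset b lam 0)
    (lam' : ℝ) (hlam'0 : 0 ≤ lam') (hlam' : lam' ≤ lam) :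
    θ ∈ BRset b lam' 0 := by
  obtain ⟨⟨h0, h1⟩, h⟩ := hmem
  obtain ⟨hb0, hb1⟩ := hb
  have hh := h (1/2) (by simp)
  have h1' := h 1 (by simp)
  unfold cost at hh h1'
  have e0 : |0 - θ| = θ := by rw [zero_sub, abs_neg, abs_of_nonneg h0]
  have e1 : |0 - b| = b := by rw [zero_sub, abs_neg, abs_of_nonneg hb0]
  have e2 : |1 - θ| = 1 - θ := abs_of_nonneg (by linarith)
  have e3 : |1 - b| = 1 - b := abs_of_nonneg (by linarith)
  rw [e0, e1] at hh h1'
  rw [e2, e3] at h1'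
  have hD : |1/2 - b| ≤ b := abs_le.mpr ⟨by linarith, by linarith⟩
  have hm : lam' * (b - |1/2 - b|) ≤ lam * (b - |1/2 - b|) :=
    mul_le_mul_of_nonneg_right hlam' (by linarith)
  have hn : 0 ≤ lam * (b - |1/2 - b|) := mul_nonneg hlam (by linarith)
  have hθ : θ ≤ 1/2 := by
    by_contra hc
    have : |1/2 - θ| = θ - 1/2 := by rw [abs_of_neg (by linarith)]; ring
    linarith
  refine ⟨⟨h0, h1⟩, ?_⟩
  intro a ha
  simp only [Set.mem_insert_iff, Set.mem_singleton_iff] at ha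
  rcases ha with rfl | rfl | rfl
  · exact le_refl _
  · unfold cost
    rw [e0, e1]
    linarith
  · unfold cost
    rw [e0, e1, e2, e3]
    rcases le_total b (1/2) with hc | hc
    · have : 0 ≤ lam' * (1 - 2 * b) := mul_nonneg hlam'0 (by linarith)
      linarith
    · have : lam' * (2 * b - 1) ≤ lam * (2 * b - 1) :=
        mul_le_mul_of_nonneg_right hlam' (by linarith)
      linarith
end

section
/- The breakpoints satisfy β < bp₁ < bp₂ < α, and ν has the following piecewise form: ν(x) = (α − x)(x − β)/(x(α − β)) for x ∈ (β, bp₁]; ν(x) = 2τ − (α + x)(x − β)/(x(α − β)) for x ∈ [bp₁, bp₂]; and ν(x) = (x − α)(x − β)/(x(α − β)) for x ∈ [bp₂, α). -/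
/-- The change `ν(x)` in distance between the receiver's belief in `C` and the sender's
credence `τ`, as a function of the receiver's credence `x` in the message `M`. -/
noncomputable def nu (a b t x : ℝ) : ℝ :=
  |t - (x - b) / (a - b)| - |t - a * (x - b) / (x * (a - b))|

/-- The first breakpoint: where the posterior equals `τ`. -/
noncomputable def bp1 (a b t : ℝ) : ℝ := a * b / (a - t * (a - b))

/-- The second breakpoint: where the prior equals `τ`. -/
noncomputable def bp2 (a b t : ℝ) : ℝ := b + t * (a - b)

theorem nu_piecewise_form
    (a b t : ℝ) (hb0 : 0 < b) (hba : b < a) (ha1 : a < 1)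
    (ht0 : 0 < t) (ht1 : t < 1) :
    b < bp1 a b t ∧ bp1 a b t < bp2 a b t ∧ bp2 a b t < a ∧
    (∀ x : ℝ, b < x → x ≤ bp1 a b t →
      nu a b t x = (a - x) * (x - b) / (x * (a - b))) ∧
    (∀ x : ℝ, bp1 a b t ≤ x → x ≤ bp2 a b t →
      nu a b t x = 2 * t - (a + x) * (x - b) / (x * (a - b))) ∧
    (∀ x : ℝ, bp2 a b t ≤ x → x < a →
      nu a b t x = (x - a) * (x - b) / (x * (a - b))) := by
  have hd : 0 < a - b := sub_pos.mpr hba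
  have htd : 0 < t * (a - b) := mul_pos ht0 hd
  have htd' : 0 < (1 - t) * (a - b) := mul_pos (sub_pos.mpr ht1) hd
  have hD : 0 < a - t * (a - b) := by linarith
  have h1 : b < bp1 a b t := by
    unfold bp1
    rw [lt_div_iff₀ hD]
    nlinarith [mul_pos hb0 htd]
  have h2 : bp1 a b t < bp2 a b t := by
    unfold bp1 bp2
    rw [div_lt_iff₀ hD]
    nlinarith [mul_pos htd htd']
  have h3 : bp2 a b t < a := by
    unfold bp2
    linarith
  have prior_le : ∀ x, x ≤ bp2 a b t → 0 ≤ t - (x - b) / (a - b) := by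
    intro x hx
    unfold bp2 at hx
    rw [sub_nonneg, div_le_iff₀ hd]
    linarith
  have prior_ge : ∀ x, bp2 a b t ≤ x → t - (x - b) / (a - b) ≤ 0 := by
    intro x hx
    unfold bp2 at hx
    rw [sub_nonpos, le_div_iff₀ hd]
    linarith
  have post_le : ∀ x, 0 < x → x ≤ bp1 a b t →
      0 ≤ t - a * (x - b) / (x * (a - b)) := by
    intro x h0 hx
    unfold bp1 at hx
    rw [le_div_iff₀ hD] at hx
    rw [sub_nonneg, div_le_iff₀ (mul_pos h0 hd)]
    linarith
  have post_ge : ∀ x, 0 < x → bp1 a b t ≤ x →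
      t - a * (x - b) / (x * (a - b)) ≤ 0 := by
    intro x h0 hx
    unfold bp1 at hx
    rw [div_le_iff₀ hD] at hx
    rw [sub_nonpos, le_div_iff₀ (mul_pos h0 hd)]
    linarith
  refine ⟨h1, h2, h3, ?_, ?_, ?_⟩
  · intro x hx hx1
    have h0 : 0 < x := by linarith
    unfold nu
    rw [abs_of_nonneg (prior_le x (by linarith)), abs_of_nonneg (post_le x h0 hx1)]
    have := hd.ne'
    field_simp
    ring
  · intro x hx hx1
    have h0 : 0 < x := by linarith
    unfold nu
    rw [abs_of_nonneg (prior_le x hx1), abs_of_nonpos (post_ge x h0 hx)]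
    have := hd.ne'
    field_simp
    ring
  · intro x hx hx1
    have h0 : 0 < x := by linarith
    unfold nu
    rw [abs_of_nonpos (prior_ge x hx), abs_of_nonpos (post_ge x h0 (by linarith))]
    have := hd.ne'
    field_simp
    ring
end

section
/- Let θ_low = min(√(αβ), bp₁). Then β < θ_low and ν is strictly monotone increasing on the interval (β, θ_low]. -/
theorem nu_eq_low (a b t x : ℝ) (hb0 : 0 < b) (hba : b < a) (ht1 : t < 1) (ht0 : 0 < t)
    (hx : b < x) (hx2 : x ≤ bp1 a b t) :
    nu a b t x = (a + b - (x + a * b / x)) / (a - b) := by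
  have hab : 0 < a - b := by linarith
  have hx0 : 0 < x := by linarith
  have hd : 0 < a - t * (a - b) := by nlinarith
  have h1 : x * (a - t * (a - b)) ≤ a * b := by
    rw [bp1, le_div_iff₀ hd] at hx2
    exact hx2
  have hxa : x ≤ a := by
    have h2 : b < a - t * (a - b) := by nlinarith
    nlinarith
  have h3 : a * (x - b) / (x * (a - b)) ≤ t := by
    rw [div_le_iff₀ (by positivity)]
    nlinarith
  have h4 : (x - b) / (a - b) ≤ a * (x - b) / (x * (a - b)) := by
    rw [div_le_div_iff₀ hab (by positivity)]
    have : 0 ≤ (x - b) * (a - b) * (a - x) :=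
      mul_nonneg (mul_nonneg (by linarith) hab.le) (by linarith)
    nlinarith
  rw [nu, abs_of_nonneg (by linarith), abs_of_nonneg (by linarith)]
  field_simp
  ring

theorem nu_strictMono_low
    (a b t : ℝ) (hb0 : 0 < b) (hba : b < a) (ha1 : a < 1)
    (ht0 : 0 < t) (ht1 : t < 1) :
    b < min (Real.sqrt (a * b)) (bp1 a b t) ∧
    StrictMonoOn (nu a b t) (Set.Ioc b (min (Real.sqrt (a * b)) (bp1 a b t))) := by
  have hab : 0 < a - b := by linarith
  have hd : 0 < a - t * (a - b) := by nlinarith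
  refine ⟨lt_min ?_ ?_, ?_⟩
  · exact Real.lt_sqrt_of_sq_lt (by nlinarith)
  · rw [bp1, lt_div_iff₀ hd]
    nlinarith [mul_pos (mul_pos hb0 ht0) hab]
  · rintro x ⟨hx1, hx2⟩ y ⟨hy1, hy2⟩ hxy
    rw [nu_eq_low a b t x hb0 hba ht1 ht0 hx1 (hx2.trans (min_le_right _ _)),
      nu_eq_low a b t y hb0 hba ht1 ht0 hy1 (hy2.trans (min_le_right _ _))]
    have hx0 : 0 < x := by linarith
    have hy0 : 0 < y := by linarith
    have hy3 : y ^ 2 ≤ a * b := by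
      have h := hy2.trans (min_le_left _ _)
      exact (Real.le_sqrt' hy0).1 h
    have hlt : x * y < a * b := by nlinarith
    have key : x + a * b / x - (y + a * b / y) = (y - x) * (a * b - x * y) / (x * y) := by
      field_simp
      ring
    have hpos : 0 < (y - x) * (a * b - x * y) / (x * y) :=
      div_pos (mul_pos (by linarith) (by linarith)) (by positivity)
    exact div_lt_div_of_pos_right (by linarith) hab
end

section
/- Let θ_low = min(√(αβ), bp₁) and θ_high = max(√(αβ), bp₂). Then θ_low < θ_high and ν is strictly monotone decreasing on the interval [θ_low, θ_high]. -/
theorem nu_aux (a b t x : ℝ) (hba : b < a) (hx : 0 < x) :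
    nu a b t x = (|bp2 a b t - x| - |a * b / x - (a - t * (a - b))|) / (a - b) := by
  have hD : 0 < a - b := by linarith
  have h1 : t - (x - b) / (a - b) = (bp2 a b t - x) / (a - b) := by
    unfold bp2; field_simp; ring
  have h2 : t - a * (x - b) / (x * (a - b)) = (a * b / x - (a - t * (a - b))) / (a - b) := by
    field_simp; ring
  unfold nu
  rw [h1, h2, abs_div, abs_div, abs_of_pos hD, sub_div]

theorem nu_strictAnti_middle
    (a b t : ℝ) (hb0 : 0 < b) (hba : b < a) (ha1 : a < 1)
    (ht0 : 0 < t) (ht1 : t < 1) :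
    min (Real.sqrt (a * b)) (bp1 a b t) < max (Real.sqrt (a * b)) (bp2 a b t) ∧
    StrictAntiOn (nu a b t)
      (Set.Icc (min (Real.sqrt (a * b)) (bp1 a b t))
        (max (Real.sqrt (a * b)) (bp2 a b t))) := by
  have hD : 0 < a - b := by linarith
  have hab : 0 < a * b := mul_pos (by linarith) hb0
  have hs : 0 < Real.sqrt (a * b) := Real.sqrt_pos.2 hab
  have hss : Real.sqrt (a * b) * Real.sqrt (a * b) = a * b := Real.mul_self_sqrt hab.le
  have haux := fun x hx => nu_aux a b t x hba hx
  have hc : 0 < a - t * (a - b) := by nlinarith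
  have hb1 : 0 < bp1 a b t := div_pos hab hc
  have hb1c : bp1 a b t * (a - t * (a - b)) = a * b := div_mul_cancel₀ _ hc.ne'
  have h12 : bp1 a b t < bp2 a b t := by
    unfold bp1 bp2
    rw [div_lt_iff₀ hc]
    nlinarith [mul_pos (mul_pos ht0 (sub_pos.2 ht1)) (mul_pos hD hD)]
  generalize Real.sqrt (a * b) = s at *
  generalize bp1 a b t = u at *
  generalize bp2 a b t = v at *
  generalize a - t * (a - b) = c at *
  generalize a * b = k at *
  have hlu : min s u ≤ u := min_le_right _ _
  have hvh : v ≤ max s v := le_max_right _ _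
  have hl : 0 < min s u := lt_min hs hb1
  refine ⟨by linarith, ?_⟩
  have key : ∀ x y, 0 < x → x < y → k / x - k / y = k * (y - x) / (x * y) := by
    intro x y hx hxy
    have : 0 < y := hx.trans hxy
    field_simp
  have le1 : ∀ x, 0 < x → x ≤ u → c ≤ k / x := by
    intro x hx h; rw [le_div_iff₀ hx]; nlinarith
  have le2 : ∀ x, 0 < x → u ≤ x → k / x ≤ c := by
    intro x hx h; rw [div_le_iff₀ hx]; nlinarith
  have A : StrictAntiOn (nu a b t) (Set.Icc (min s u) u) := by
    rintro x ⟨hx1, hx2⟩ y ⟨hy1, hy2⟩ hxy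
    have hx : 0 < x := by linarith
    have hy : 0 < y := by linarith
    have hsx : s ≤ x := by
      rcases min_le_iff.1 hx1 with h | h <;> linarith
    rw [haux x hx, haux y hy]
    apply div_lt_div_of_pos_right _ hD
    rw [abs_of_nonneg (by linarith : 0 ≤ v - x), abs_of_nonneg (by linarith : 0 ≤ v - y),
      abs_of_nonneg (sub_nonneg.2 (le1 x hx hx2)), abs_of_nonneg (sub_nonneg.2 (le1 y hy hy2))]
    have := key x y hx hxy
    have : k * (y - x) / (x * y) < y - x := by
      rw [div_lt_iff₀ (mul_pos hx hy)]
      have : k < x * y := by nlinarith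
      nlinarith
    linarith
  have B : StrictAntiOn (nu a b t) (Set.Icc u v) := by
    rintro x ⟨hx1, hx2⟩ y ⟨hy1, hy2⟩ hxy
    have hx : 0 < x := by linarith
    have hy : 0 < y := by linarith
    rw [haux x hx, haux y hy]
    apply div_lt_div_of_pos_right _ hD
    rw [abs_of_nonneg (by linarith : 0 ≤ v - x), abs_of_nonneg (by linarith : 0 ≤ v - y),
      abs_of_nonpos (sub_nonpos.2 (le2 x hx hx1)), abs_of_nonpos (sub_nonpos.2 (le2 y hy hy1))]
    have := key x y hx hxy
    have : 0 < k * (y - x) / (x * y) :=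
      div_pos (mul_pos hab (by linarith)) (mul_pos hx hy)
    linarith
  have C : StrictAntiOn (nu a b t) (Set.Icc v (max s v)) := by
    rintro x ⟨hx1, hx2⟩ y ⟨hy1, hy2⟩ hxy
    have hx : 0 < x := by linarith
    have hy : 0 < y := by linarith
    have hsy : y ≤ s := by
      rcases le_max_iff.1 hy2 with h | h <;> linarith
    rw [haux x hx, haux y hy]
    apply div_lt_div_of_pos_right _ hD
    rw [abs_of_nonpos (by linarith : v - x ≤ 0), abs_of_nonpos (by linarith : v - y ≤ 0),
      abs_of_nonpos (sub_nonpos.2 (le2 x hx (by linarith))),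
      abs_of_nonpos (sub_nonpos.2 (le2 y hy (by linarith)))]
    have := key x y hx hxy
    have : y - x < k * (y - x) / (x * y) := by
      rw [lt_div_iff₀ (mul_pos hx hy)]
      have : x * y < k := by nlinarith
      nlinarith
    linarith
  have AB := A.union B (isGreatest_Icc hlu) (isLeast_Icc h12.le)
  rw [Set.Icc_union_Icc_eq_Icc hlu h12.le] at AB
  have ABC := AB.union C (isGreatest_Icc (hlu.trans h12.le)) (isLeast_Icc hvh)
  rwa [Set.Icc_union_Icc_eq_Icc (hlu.trans h12.le) hvh] at ABC
end

section
/- Let θ_high = max(√(αβ), bp₂). Then θ_high < α and ν is strictly monotone increasing on the interval [θ_high, α). -/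
theorem nu_strictMono_high
    (a b t : ℝ) (hb0 : 0 < b) (hba : b < a) (ha1 : a < 1)
    (ht0 : 0 < t) (ht1 : t < 1) :
    max (Real.sqrt (a * b)) (bp2 a b t) < a ∧
    StrictMonoOn (nu a b t) (Set.Ico (max (Real.sqrt (a * b)) (bp2 a b t)) a) := by
  have hab : 0 < a - b := sub_pos.2 hba
  have ha : 0 < a := hb0.trans hba
  have key : ∀ x, bp2 a b t ≤ x → x < a →
      nu a b t x = (x + a * b / x - (a + b)) / (a - b) := by
    intro x h1 h2
    unfold bp2 at h1
    have hx : 0 < x := by nlinarith [mul_pos ht0 hab]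
    have hp : t ≤ (x - b) / (a - b) := by
      rw [le_div_iff₀ hab]; linarith
    have hxb : 0 ≤ x - b := by nlinarith [mul_pos ht0 hab]
    have hq : (x - b) / (a - b) ≤ a * (x - b) / (x * (a - b)) := by
      rw [div_le_div_iff₀ hab (mul_pos hx hab)]
      nlinarith [mul_nonneg (mul_nonneg hxb hab.le) (sub_nonneg.2 h2.le)]
    unfold nu
    rw [abs_of_nonpos (by linarith), abs_of_nonpos (by linarith)]
    field_simp
    ring
  refine ⟨max_lt ?_ ?_, ?_⟩
  · rw [Real.sqrt_lt' ha]
    nlinarith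
  · unfold bp2
    nlinarith
  · rintro x ⟨hx1, hx2⟩ y ⟨hy1, hy2⟩ hxy
    have hs := (le_max_left _ _).trans hx1
    have hx : 0 < x := lt_of_lt_of_le (Real.sqrt_pos.2 (mul_pos ha hb0)) hs
    have hsq : a * b ≤ x ^ 2 := (Real.sqrt_le_left hx.le).1 hs
    have hy : 0 < y := hx.trans hxy
    rw [key x ((le_max_right _ _).trans hx1) hx2, key y ((le_max_right _ _).trans hy1) hy2]
    apply div_lt_div_of_pos_right _ hab
    have e : (y + a * b / y) - (x + a * b / x) = (y - x) * (x * y - a * b) / (x * y) := by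
      field_simp
      ring
    have : 0 < (y - x) * (x * y - a * b) / (x * y) := by
      apply div_pos (mul_pos (sub_pos.2 hxy) _) (mul_pos hx hy)
      nlinarith
    linarith
end
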